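/- Invertibility of the Wrapped Hyperboloid Coupling transport step: let o be the origin of ℍⁿ_K, let t ∈ ℍⁿ_K with t ≠ o, and let v ∈ T_o be a nonzero tangent vector at the origin. Set w = exp_t(PT_{o→t}(v)) and assume w ≠ o and w ≠ t. Then, with z = log_o(w) ∈ T_o, one recovers v by transporting back: PT_{t→o}(log_t(exp_o(z))) = v. -/

import Mathlib

open scoped BigOperators

/-- The Lorentz (Minkowski) inner product on `ℝ^{n+1}`:
`⟨x,y⟩_L = -x₀y₀ + Σ_{i=1}^n xᵢyᵢ`. -/
noncomputable def lorentz {n : ℕ} (x y : Fin (n + 1) → ℝ) : ℝ :=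
  -(x 0 * y 0) + ∑ i : Fin n, x i.succ * y i.succ

/-- Membership in the hyperboloid model `ℍⁿ_K` of curvature `K < 0`. -/
def onHyperboloid {n : ℕ} (K : ℝ) (x : Fin (n + 1) → ℝ) : Prop :=
  lorentz x x = 1 / K ∧ 0 < x 0

/-- The Lorentz norm `‖u‖_L = √⟨u,u⟩_L` (for vectors with `⟨u,u⟩_L ≥ 0`). -/
noncomputable def lnorm {n : ℕ} (u : Fin (n + 1) → ℝ) : ℝ :=
  Real.sqrt (lorentz u u)

/-- The inverse hyperbolic cosine `arccosh x = log (x + √(x² - 1))`. -/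
noncomputable def arcosh (x : ℝ) : ℝ :=
  Real.log (x + Real.sqrt (x ^ 2 - 1))

/-- The exponential map of the hyperboloid with generalized radius `R`:
`exp_x(v) = cosh(‖v‖_L/R)·x + sinh(‖v‖_L/R)·(R/‖v‖_L)·v`. -/
noncomputable def expMap {n : ℕ} (R : ℝ) (x v : Fin (n + 1) → ℝ) : Fin (n + 1) → ℝ :=
  Real.cosh (lnorm v / R) • x + (Real.sinh (lnorm v / R) * (R / lnorm v)) • v

/-- The logarithmic map of the hyperboloid of curvature `K`:
`log_x(y) = (arccosh α / √(α² − 1))·(y − αx)` with `α = K⟨x,y⟩_L`. -/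
noncomputable def logMap {n : ℕ} (K : ℝ) (x y : Fin (n + 1) → ℝ) : Fin (n + 1) → ℝ :=
  (arcosh (K * lorentz x y) / Real.sqrt ((K * lorentz x y) ^ 2 - 1)) •
    (y - (K * lorentz x y) • x)

/-- The hyperbolic distance `d(x,y) = R·arccosh(K⟨x,y⟩_L)`. -/
noncomputable def hdist {n : ℕ} (K R : ℝ) (x y : Fin (n + 1) → ℝ) : ℝ :=
  R * arcosh (K * lorentz x y)

/-- Parallel transport from `x` to `y` on the hyperboloid of generalized radius `R`:
`PT_{x→y}(v) = v + (⟨y,v⟩_L/(R² − ⟨x,y⟩_L))·(x+y)`. -/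
noncomputable def pt {n : ℕ} (R : ℝ) (x y v : Fin (n + 1) → ℝ) : Fin (n + 1) → ℝ :=
  v + (lorentz y v / (R ^ 2 - lorentz x y)) • (x + y)

/-- The origin `o = (R, 0, …, 0)` of the hyperboloid. -/
noncomputable def origin {n : ℕ} (R : ℝ) : Fin (n + 1) → ℝ :=
  fun i => if i = 0 then R else 0

lemma lor_comm {n : ℕ} (x y : Fin (n + 1) → ℝ) : lorentz x y = lorentz y x := by
  simp [lorentz, mul_comm]

lemma lor_add {n : ℕ} (x y z : Fin (n + 1) → ℝ) :
    lorentz x (y + z) = lorentz x y + lorentz x z := by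
  simp only [lorentz, Pi.add_apply, mul_add, Finset.sum_add_distrib]; ring

lemma lor_smul {n : ℕ} (a : ℝ) (x y : Fin (n + 1) → ℝ) :
    lorentz x (a • y) = a * lorentz x y := by
  simp only [lorentz, Pi.smul_apply, smul_eq_mul, mul_add, Finset.mul_sum]
  congr 1
  · ring
  · exact Finset.sum_congr rfl fun i _ => by ring

lemma lor_sub {n : ℕ} (x y z : Fin (n + 1) → ℝ) :
    lorentz x (y - z) = lorentz x y - lorentz x z := by
  simp only [lorentz, Pi.sub_apply, mul_sub, Finset.sum_sub_distrib]; ring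

lemma lor_add' {n : ℕ} (x y z : Fin (n + 1) → ℝ) :
    lorentz (y + z) x = lorentz y x + lorentz z x := by
  rw [lor_comm, lor_add, lor_comm x y, lor_comm x z]

lemma lor_smul' {n : ℕ} (a : ℝ) (x y : Fin (n + 1) → ℝ) :
    lorentz (a • y) x = a * lorentz y x := by
  rw [lor_comm, lor_smul, lor_comm]

lemma lor_sub' {n : ℕ} (x y z : Fin (n + 1) → ℝ) :
    lorentz (y - z) x = lorentz y x - lorentz z x := by
  rw [lor_comm, lor_sub, lor_comm x y, lor_comm x z]

lemma lor_origin {n : ℕ} (R : ℝ) (x : Fin (n + 1) → ℝ) :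
    lorentz (origin R) x = -(R * x 0) := by
  simp [lorentz, origin, Fin.succ_ne_zero]

lemma arcosh_cosh' {θ : ℝ} (h : 0 < θ) : arcosh (Real.cosh θ) = θ := by
  have h1 : Real.cosh θ ^ 2 - 1 = Real.sinh θ ^ 2 := by rw [Real.cosh_sq]; ring
  rw [arcosh, h1, Real.sqrt_sq (Real.sinh_pos_iff.2 h).le, Real.cosh_add_sinh, Real.log_exp]

lemma cosh_surj {a : ℝ} (h : 1 < a) : ∃ θ, 0 < θ ∧ Real.cosh θ = a := by
  have hs : 0 < Real.sqrt (a ^ 2 - 1) := Real.sqrt_pos.2 (by nlinarith)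
  refine ⟨Real.arsinh (Real.sqrt (a ^ 2 - 1)), Real.arsinh_pos_iff.2 hs, ?_⟩
  rw [Real.cosh_arsinh, Real.sq_sqrt (by nlinarith)]
  rw [show 1 + (a ^ 2 - 1) = a ^ 2 by ring, Real.sqrt_sq (by linarith)]

lemma exp_log' {n : ℕ} {K R : ℝ} (hR : 0 < R) (hKR : K * R ^ 2 = -1)
    {x y : Fin (n + 1) → ℝ} (hx : lorentz x x = -R ^ 2) (hy : lorentz y y = -R ^ 2)
    (ha : 1 < K * lorentz x y) : expMap R x (logMap K x y) = y := by
  obtain ⟨θ, hθ, hc⟩ := cosh_surj ha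
  have hs := Real.sinh_pos_iff.2 hθ
  have h1 : Real.cosh θ ^ 2 - 1 = Real.sinh θ ^ 2 := by rw [Real.cosh_sq]; ring
  have hxy : lorentz x y = -R ^ 2 * Real.cosh θ := by
    rw [hc]; linear_combination (lorentz x y) * hKR
  have hyx : lorentz y x = -R ^ 2 * Real.cosh θ := by rw [lor_comm, hxy]
  have hl : logMap K x y = (θ / Real.sinh θ) • (y - Real.cosh θ • x) := by
    rw [logMap, ← hc, arcosh_cosh' hθ, h1, Real.sqrt_sq hs.le]
  have hn : lnorm (logMap K x y) = R * θ := by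
    rw [lnorm, hl, ← Real.sqrt_sq (mul_pos hR hθ).le]
    congr 1
    simp only [lor_smul, lor_smul', lor_sub, lor_sub', hx, hy, hxy, hyx]
    field_simp
    linear_combination h1
  rw [expMap, hn, hl, mul_div_cancel_left₀ _ hR.ne', smul_smul]
  have : Real.sinh θ * (R / (R * θ)) * (θ / Real.sinh θ) = 1 := by field_simp
  rw [this, one_smul]; abel

lemma log_exp' {n : ℕ} {K R : ℝ} (hR : 0 < R) (hKR : K * R ^ 2 = -1)
    {x u : Fin (n + 1) → ℝ} (hx : lorentz x x = -R ^ 2) (hxu : lorentz x u = 0)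
    (hu : 0 < lorentz u u) : logMap K x (expMap R x u) = u := by
  have hn : 0 < lnorm u := Real.sqrt_pos.2 hu
  have hθ : 0 < lnorm u / R := div_pos hn hR
  have ha : K * lorentz x (expMap R x u) = Real.cosh (lnorm u / R) := by
    simp only [expMap, lor_add, lor_smul, hx, hxu]
    linear_combination (-Real.cosh (lnorm u / R)) * hKR
  have hs := Real.sinh_pos_iff.2 hθ
  have h1 : Real.cosh (lnorm u / R) ^ 2 - 1 = Real.sinh (lnorm u / R) ^ 2 := by
    rw [Real.cosh_sq]; ring
  rw [logMap, ha, arcosh_cosh' hθ, h1, Real.sqrt_sq hs.le, expMap, add_sub_cancel_left, smul_smul]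
  have : lnorm u / R / Real.sinh (lnorm u / R) * (Real.sinh (lnorm u / R) * (R / lnorm u)) = 1 := by
    field_simp
  rw [this, one_smul]

lemma exp_norm {n : ℕ} {R : ℝ} (hR : 0 < R)
    {x u : Fin (n + 1) → ℝ} (hx : lorentz x x = -R ^ 2) (hxu : lorentz x u = 0)
    (hu : 0 < lorentz u u) : lorentz (expMap R x u) (expMap R x u) = -R ^ 2 := by
  have hn : 0 < lnorm u := Real.sqrt_pos.2 hu
  have h2 : lorentz u u = lnorm u ^ 2 := (Real.sq_sqrt hu.le).symm
  have hux : lorentz u x = 0 := by rw [lor_comm, hxu]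
  have h1 := Real.cosh_sq (lnorm u / R)
  simp only [expMap, lor_add, lor_smul, lor_add', lor_smul', hx, hxu, hux, h2]
  field_simp
  linear_combination (-(lnorm u * R)) * h1

lemma exp_zero_pos {n : ℕ} {R : ℝ} (hR : 0 < R)
    {x u : Fin (n + 1) → ℝ} (hx : lorentz x x = -R ^ 2) (hx0 : 0 < x 0) (hxu : lorentz x u = 0)
    (hu : 0 < lorentz u u) : 0 < expMap R x u 0 := by
  have hn : 0 < lnorm u := Real.sqrt_pos.2 hu
  have h2 : lorentz u u = lnorm u ^ 2 := (Real.sq_sqrt hu.le).symm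
  have hθ : 0 < lnorm u / R := div_pos hn hR
  have hs := Real.sinh_pos_iff.2 hθ
  have hcs := Finset.sum_mul_sq_le_sq_mul_sq Finset.univ
    (fun i : Fin n => x i.succ) (fun i : Fin n => u i.succ)
  have e1 : ∑ i : Fin n, x i.succ * u i.succ = x 0 * u 0 := by
    unfold lorentz at hxu; linarith
  have e2 : ∑ i : Fin n, x i.succ ^ 2 = x 0 ^ 2 - R ^ 2 := by
    simp only [lorentz, ← pow_two] at hx; linarith
  have e3 : ∑ i : Fin n, u i.succ ^ 2 = u 0 ^ 2 + lnorm u ^ 2 := by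
    simp only [lorentz, ← pow_two] at h2; linarith
  rw [e1, e2, e3] at hcs
  have h3 : (R * u 0) ^ 2 ≤ (x 0 * lnorm u) ^ 2 := by
    nlinarith [mul_pos (pow_pos hR 2) (pow_pos hn 2)]
  have h4 := neg_le_of_abs_le (abs_le_of_sq_le_sq h3 (mul_pos hx0 hn).le)
  have h5 : - x 0 ≤ R / lnorm u * u 0 := by
    rw [div_mul_eq_mul_div, le_div_iff₀ hn]; linarith
  simp only [expMap, Pi.add_apply, Pi.smul_apply, smul_eq_mul]
  have h6 := mul_le_mul_of_nonneg_left h5 hs.le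
  have h7 := mul_pos (sub_pos.2 (Real.sinh_lt_cosh (lnorm u / R))) hx0
  nlinarith

lemma ne_origin_gt {n : ℕ} {R : ℝ} (hR : 0 < R)
    {w : Fin (n + 1) → ℝ} (hw : lorentz w w = -R ^ 2) (hw0 : 0 < w 0) (h : w ≠ origin R) :
    R < w 0 := by
  simp only [lorentz, ← pow_two] at hw
  have hnn : 0 ≤ ∑ i : Fin n, w i.succ ^ 2 := Finset.sum_nonneg fun i _ => sq_nonneg _
  have hle : R ≤ w 0 := by nlinarith
  refine lt_of_le_of_ne hle fun he => h ?_
  have hz : ∑ i : Fin n, w i.succ ^ 2 = 0 := by rw [← he] at hw; linarith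
  rw [Finset.sum_eq_zero_iff_of_nonneg fun i _ => sq_nonneg _] at hz
  funext i
  refine Fin.cases ?_ (fun j => ?_) i
  · simp [origin, he]
  · simpa [origin, Fin.succ_ne_zero] using hz j (Finset.mem_univ j)

/-- invertibility of the Wrapped Hyperboloid Coupling
transport step: with `w = exp_t(PT_{o→t}(v))` and `z = log_o(w)`, one
recovers `v` via `PT_{t→o}(log_t(exp_o(z))) = v`. -/
theorem whc_transport_invertible {n : ℕ} (K R : ℝ) (hK : K < 0)
    (hR : R = 1 / Real.sqrt (-K))
    (t : Fin (n + 1) → ℝ) (ht : onHyperboloid K t) (hto : t ≠ origin R)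
    (v : Fin (n + 1) → ℝ) (hv : lorentz v (origin R) = 0) (hv0 : v ≠ 0)
    (w : Fin (n + 1) → ℝ) (hw : w = expMap R t (pt R (origin R) t v))
    (hwo : w ≠ origin R) (hwt : w ≠ t) :
    pt R t (origin R) (logMap K t (expMap R (origin R) (logMap K (origin R) w))) = v := by
  have hR0 : 0 < R := by rw [hR]; exact one_div_pos.2 (Real.sqrt_pos.2 (by linarith))
  have hKR : K * R ^ 2 = -1 := by
    rw [hR, div_pow, Real.sq_sqrt (by linarith)]
    have := hK.ne
    field_simp
  obtain ⟨ht1, ht0⟩ := ht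
  have htt : lorentz t t = -R ^ 2 := by
    rw [ht1]
    have := hK.ne
    field_simp
    linarith
  have hoo : lorentz (origin R : Fin (n + 1) → ℝ) (origin R) = -R ^ 2 := by
    rw [lor_origin]; simp [origin]; ring
  have hov : lorentz (origin R) v = 0 := by rw [lor_comm, hv]
  have hot : lorentz (origin R) t = -(R * t 0) := lor_origin R t
  have hto' : lorentz t (origin R) = -(R * t 0) := by rw [lor_comm, hot]
  have hD : R ^ 2 + R * t 0 ≠ 0 := by positivity
  have hvv : 0 < lorentz v v := by
    have h0 : v 0 = 0 := by
      rw [lor_origin] at hov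
      have := hR0.ne'
      simpa [this] using hov
    have hnn : 0 ≤ ∑ i : Fin n, v i.succ ^ 2 := Finset.sum_nonneg fun i _ => sq_nonneg _
    simp only [lorentz, ← pow_two, h0]
    refine lt_of_le_of_ne (by linarith) fun he => hv0 ?_
    have hz : ∑ i : Fin n, v i.succ ^ 2 = 0 := by linarith
    rw [Finset.sum_eq_zero_iff_of_nonneg fun i _ => sq_nonneg _] at hz
    funext i
    refine Fin.cases h0 (fun j => ?_) i
    simpa using hz j (Finset.mem_univ j)
  set u := pt R (origin R) t v with hu
  obtain ⟨a, ha, hua⟩ : ∃ a : ℝ, a * (R ^ 2 + R * t 0) = lorentz t v ∧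
      u = v + a • (origin R + t) := by
    refine ⟨lorentz t v / (R ^ 2 + R * t 0), div_mul_cancel₀ _ hD, ?_⟩
    rw [hu, pt, hot, sub_neg_eq_add]
  have hvt : lorentz v t = lorentz t v := lor_comm _ _
  have htu : lorentz t u = 0 := by
    rw [hua]; simp only [lor_add, lor_smul, htt, hto']; linear_combination -ha
  have huu : 0 < lorentz u u := by
    have : lorentz u u = lorentz v v := by
      rw [hua]
      simp only [lor_add, lor_smul, lor_add', lor_smul', htt, hto', hot, hoo, hov, hv, hvt]
      linear_combination (-2 * a) * ha
    rw [this]; exact hvv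
  have hou : lorentz (origin R) u = -lorentz t v := by
    rw [hua]; simp only [lor_add, lor_smul, hoo, hot, hov]; linear_combination -ha
  have hww : lorentz w w = -R ^ 2 := by rw [hw]; exact exp_norm hR0 htt htu huu
  have hw0 : 0 < w 0 := by rw [hw]; exact exp_zero_pos hR0 htt ht0 htu huu
  have hgt := ne_origin_gt hR0 hww hw0 hwo
  have hal : 1 < K * lorentz (origin R) w := by
    rw [lor_origin]
    have hp : 0 < -K * R := mul_pos (by linarith) hR0
    nlinarith
  rw [exp_log' hR0 hKR hoo hww hal, hw, log_exp' hR0 hKR htt htu huu, pt, hou, hto',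
    sub_neg_eq_add, ← ha, hua, neg_div, mul_div_cancel_right₀ _ hD, add_comm t]
  module
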